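/- Theorem 4(a) (three-layer sampling): let B₁ : Matrix V E ℝ and B₂ : Matrix E T ℝ, let F₀ : Matrix V V ℝ, F_H : Matrix E E ℝ, F₂ : Matrix T T ℝ, and let D_A : Matrix V V ℝ, D_S : Matrix E E ℝ, D_M : Matrix T T ℝ be diagonal matrices with diagonal entries in {0,1}. Suppose the ℓ²-operator norms of (1 − D_A) * F₀, of (1 − D_S) * F_H, and of (1 − D_M) * F₂ are all strictly less than 1. Let s⁰ ∈ ℝ^V with F₀.mulVec s⁰ = s⁰, s_H ∈ ℝ^E with F_H.mulVec s_H = s_H, s² ∈ ℝ^T with F₂.mulVec s² = s², and s¹ := B₂.mulVec s² + s_H + B₁ᵀ.mulVec s⁰. Then the matrices 1 − (1 − D_A) * F₀, 1 − (1 − D_S) * F_H and 1 − (1 − D_M) * F₂ are invertible, and setting s⁰_rec := (1 − (1 − D_A) * F₀)⁻¹.mulVec (D_A.mulVec s⁰) and s²_rec := (1 − (1 − D_M) * F₂)⁻¹.mulVec (D_M.mulVec s²), one has s⁰ = s⁰_rec, s² = s²_rec, and s_H = (1 − (1 − D_S) * F_H)⁻¹.mulVec (D_S.mulVec s¹ −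 D_S.mulVec (B₁ᵀ.mulVec s⁰_rec) − D_S.mulVec (B₂.mulVec s²_rec)). -/

import Mathlib

open Matrix

/-- The ℓ²-operator norm of a real square matrix, i.e. the operator norm of the induced
linear map on the corresponding Euclidean space. -/
noncomputable def l2OpNorm {ι : Type*} [Fintype ι] [DecidableEq ι] (M : Matrix ι ι ℝ) : ℝ :=
  ‖LinearMap.toContinuousLinearMap (Matrix.toEuclideanLin M)‖

open scoped Matrix.Norms.L2Operator in
theorem isUnit_one_sub_of_l2OpNorm_lt_one {ι : Type*} [Fintype ι] [DecidableEq ι]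
    {M : Matrix ι ι ℝ} (h : l2OpNorm M < 1) : IsUnit (1 - M) :=
  isUnit_one_sub_of_norm_lt_one (x := M) (by rwa [Matrix.l2_opNorm_def])

/-- A bandlimited signal is recovered from its samples. -/
theorem eq_inv_mulVec_sample {ι : Type*} [Fintype ι] [DecidableEq ι]
    {D F : Matrix ι ι ℝ} (h : IsUnit (1 - (1 - D) * F)) {s : ι → ℝ} (hs : F.mulVec s = s) :
    s = (1 - (1 - D) * F)⁻¹.mulVec (D.mulVec s) := by
  have key : (1 - (1 - D) * F).mulVec s = D.mulVec s := by
    rw [sub_mulVec, ← mulVec_mulVec, hs, sub_mulVec, one_mulVec, sub_sub_cancel]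
  rw [← key, mulVec_mulVec, nonsing_inv_mul _ ((isUnit_iff_isUnit_det _).mp h), one_mulVec]

/-- Theorem 4(a): three-layer sampling. The vertex signal `s⁰`, the triangle signal `s²`
and the harmonic part `s_H` of the edge signal `s¹ = B₂ s² + s_H + B₁ᵀ s⁰` are perfectly
recovered from the samples `D_A s⁰`, `D_S s¹` and `D_M s²`. -/
theorem three_layer_sampling {V E T : Type*}
    [Fintype V] [Fintype E] [Fintype T] [DecidableEq V] [DecidableEq E] [DecidableEq T]
    (B₁ : Matrix V E ℝ) (B₂ : Matrix E T ℝ)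
    (F₀ : Matrix V V ℝ) (FH : Matrix E E ℝ) (F₂ : Matrix T T ℝ)
    (DA : Matrix V V ℝ) (DS : Matrix E E ℝ) (DM : Matrix T T ℝ)
    (hDAdiag : ∀ i j, i ≠ j → DA i j = 0) (hDA01 : ∀ i, DA i i = 0 ∨ DA i i = 1)
    (hDSdiag : ∀ i j, i ≠ j → DS i j = 0) (hDS01 : ∀ i, DS i i = 0 ∨ DS i i = 1)
    (hDMdiag : ∀ i j, i ≠ j → DM i j = 0) (hDM01 : ∀ i, DM i i = 0 ∨ DM i i = 1)
    (hA : l2OpNorm ((1 - DA) * F₀) < 1) (hS : l2OpNorm ((1 - DS) * FH) < 1)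
    (hM : l2OpNorm ((1 - DM) * F₂) < 1)
    (s0 : V → ℝ) (hs0 : F₀.mulVec s0 = s0)
    (sH : E → ℝ) (hsH : FH.mulVec sH = sH)
    (s2 : T → ℝ) (hs2 : F₂.mulVec s2 = s2) :
    IsUnit (1 - (1 - DA) * F₀) ∧ IsUnit (1 - (1 - DS) * FH) ∧ IsUnit (1 - (1 - DM) * F₂) ∧
    (let s1 : E → ℝ := B₂.mulVec s2 + sH + B₁ᵀ.mulVec s0
     let s0rec : V → ℝ := (1 - (1 - DA) * F₀)⁻¹.mulVec (DA.mulVec s0)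
     let s2rec : T → ℝ := (1 - (1 - DM) * F₂)⁻¹.mulVec (DM.mulVec s2)
     s0 = s0rec ∧ s2 = s2rec ∧
     sH = (1 - (1 - DS) * FH)⁻¹.mulVec
        (DS.mulVec s1 - DS.mulVec (B₁ᵀ.mulVec s0rec) - DS.mulVec (B₂.mulVec s2rec))) := by
  have uA := isUnit_one_sub_of_l2OpNorm_lt_one hA
  have uS := isUnit_one_sub_of_l2OpNorm_lt_one hS
  have uM := isUnit_one_sub_of_l2OpNorm_lt_one hM
  refine ⟨uA, uS, uM, eq_inv_mulVec_sample uA hs0, eq_inv_mulVec_sample uM hs2, ?_⟩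
  rw [← eq_inv_mulVec_sample uA hs0, ← eq_inv_mulVec_sample uM hs2, ← mulVec_sub, ← mulVec_sub,
    add_sub_cancel_right, add_sub_cancel_left]
  exact eq_inv_mulVec_sample uS hsH
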